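/- There exists a continuous loop l : [0,1] → ℝ² of finite p-variation for every p > 1 whose topological winding-number function n_l is not square-integrable: ∫_{ℝ²} n_l(x)² dx = +∞. -/

import Mathlib

open MeasureTheory

namespace LoopWinding

/-- The loop: on `1/t ∈ [n, n+1]` it runs once through the circle of radius `1/n`
centred at `-1/n`. -/
noncomputable def lp (t : ℝ) : ℂ :=
  (Complex.exp (Complex.I * ((-(2 * Real.pi) * (1 / t) : ℝ) : ℂ)) - 1) / (⌊1 / t⌋₊ : ℂ)

noncomputable def ee (τ : ℝ) : ℂ := Complex.exp (Complex.I * ((-(2 * Real.pi) * τ : ℝ) : ℂ))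

lemma lp_def (t : ℝ) : lp t = (ee (1 / t) - 1) / (⌊1 / t⌋₊ : ℂ) := rfl

lemma ee_nat (n : ℕ) : ee n = 1 := by
  unfold ee
  rw [Complex.exp_eq_one_iff]
  refine ⟨-n, ?_⟩
  push_cast
  ring

lemma norm_ee (a : ℝ) : ‖ee a‖ = 1 := by
  unfold ee
  rw [mul_comm]
  exact Complex.norm_exp_ofReal_mul_I _

lemma ee_sub (a b : ℝ) : ‖ee a - ee b‖ ≤ 2 * Real.pi * |a - b| := by
  have h : ee a - ee b = ee b * (Complex.exp (Complex.I * ((-(2 * Real.pi) * (a - b) : ℝ) : ℂ)) - 1) := by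
    unfold ee
    rw [mul_sub, ← Complex.exp_add, mul_one]
    congr 2
    push_cast
    ring
  rw [h, norm_mul, norm_ee, one_mul]
  refine (Real.norm_exp_I_mul_ofReal_sub_one_le).trans ?_
  rw [Real.norm_eq_abs, abs_mul, abs_neg, abs_of_pos Real.two_pi_pos]

lemma lp_piece {n : ℕ} {t : ℝ} (h1 : (n : ℝ) ≤ 1 / t) (h2 : 1 / t ≤ n + 1) :
    lp t = (ee (1 / t) - 1) / (n : ℂ) := by
  rcases h2.lt_or_eq with h | h
  · rw [lp_def, (Nat.floor_eq_iff (by linarith [Nat.cast_nonneg (α := ℝ) n])).2 ⟨h1, h⟩]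
  · have : ee (1 / t) = 1 := by
      rw [h]; exact_mod_cast ee_nat (n + 1)
    rw [lp_def, this]; simp

lemma lp_zero : lp 0 = 0 := by simp [lp]

lemma lp_inv (n : ℕ) : lp (1 / (n : ℝ)) = 0 := by
  rw [lp_def, one_div_one_div, ee_nat]; simp

lemma lp_one : lp 1 = 0 := by simpa using lp_inv 1

lemma rpow_tangent {x q : ℝ} (hx : 0 < x) (hq : 0 < q) : q * (1 - x) ≤ x ^ (-q) - 1 := by
  rw [Real.rpow_def_of_pos hx]
  have h1 := Real.add_one_le_exp (Real.log x * -q)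
  have h2 := Real.log_le_sub_one_of_pos hx
  nlinarith

/-- control on a single piece. -/
lemma piece_bound {p : ℝ} (hp : 1 < p) {n : ℕ} (hn : 1 ≤ n) {s t : ℝ} (hs : 0 < s) (hst : s ≤ t)
    (h1 : (n : ℝ) ≤ 1 / t) (h2 : 1 / s ≤ n + 1) :
    ‖lp t - lp s‖ ^ p ≤ (4 * Real.pi) ^ p / (p - 1) * (t ^ (p - 1) - s ^ (p - 1)) := by
  have ht : 0 < t := hs.trans_le hst
  have hts : 1 / t ≤ 1 / s := one_div_le_one_div_of_le hs hst
  have hn' : (1 : ℝ) ≤ n := by exact_mod_cast hn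
  have hpi := Real.pi_pos
  rw [lp_piece h1 (hts.trans h2), lp_piece (h1.trans hts) h2, ← sub_div, norm_div,
    Complex.norm_natCast, sub_sub_sub_cancel_right]
  set d := 1 / s - 1 / t with hd
  have hd0 : 0 ≤ d := by linarith
  have hd1 : d ≤ 1 := by linarith
  have e1 : ‖ee (1 / t) - ee (1 / s)‖ / n ≤ (4 * Real.pi) * s * d := by
    have := ee_sub (1 / t) (1 / s)
    rw [abs_sub_comm, abs_of_nonneg hd0] at this
    rw [div_le_iff₀ (by linarith)]
    refine this.trans ?_
    have h3 : 1 ≤ s * (n + 1) := by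
      rw [div_le_iff₀ hs] at h2; linarith
    have h4 : 1 ≤ s * (2 * n) := h3.trans (by gcongr; linarith)
    have : 0 ≤ 2 * Real.pi * d := by positivity
    nlinarith
  have e2 : (‖ee (1 / t) - ee (1 / s)‖ / n) ^ p ≤ (4 * Real.pi) ^ p * s ^ p * d := by
    refine (Real.rpow_le_rpow (by positivity) e1 (by linarith)).trans ?_
    rw [Real.mul_rpow (by positivity) hd0, Real.mul_rpow (by positivity) hs.le]
    gcongr
    calc d ^ p ≤ d ^ (1 : ℝ) := Real.rpow_le_rpow_of_exponent_ge' hd0 hd1 (by norm_num) hp.le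
      _ = d := Real.rpow_one d
  have e3 : (p - 1) * (s ^ p * d) ≤ t ^ (p - 1) - s ^ (p - 1) := by
    have := rpow_tangent (x := s / t) (q := p - 1) (by positivity) (by linarith)
    have e4 : (s / t) ^ (-(p - 1)) = t ^ (p - 1) / s ^ (p - 1) := by
      rw [Real.rpow_neg (by positivity), Real.div_rpow hs.le ht.le, inv_div]
    have e5 : s ^ p = s ^ (p - 1) * s := by
      rw [← Real.rpow_add_one hs.ne']; ring_nf
    have hsp : 0 < s ^ (p - 1) := by positivity
    rw [e4] at this
    have e6 : s * d = 1 - s / t := by rw [hd]; field_simp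
    calc (p - 1) * (s ^ p * d) = s ^ (p - 1) * ((p - 1) * (1 - s / t)) := by
          rw [e5, ← e6]; ring
      _ ≤ s ^ (p - 1) * (t ^ (p - 1) / s ^ (p - 1) - 1) := by gcongr
      _ = _ := by field_simp
  refine e2.trans ?_
  have : 0 < p - 1 := by linarith
  calc (4 * Real.pi) ^ p * s ^ p * d = (4 * Real.pi) ^ p / (p - 1) * ((p - 1) * (s ^ p * d)) := by
        field_simp
    _ ≤ _ := by gcongr

lemma floor_facts {t : ℝ} (ht : 0 < t) (ht1 : t ≤ 1) :
    1 ≤ ⌊1 / t⌋₊ ∧ (⌊1 / t⌋₊ : ℝ) ≤ 1 / t ∧ 1 / t ≤ (⌊1 / t⌋₊ : ℝ) + 1 := by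
  refine ⟨Nat.le_floor ?_, Nat.floor_le (by positivity), (Nat.lt_floor_add_one _).le⟩
  rw [le_div_iff₀ ht]; simpa using ht1

/-- bound by the start of the piece -/
lemma start_bound {p : ℝ} (hp : 1 < p) {t : ℝ} (ht : 0 < t) (ht1 : t ≤ 1) :
    ‖lp t‖ ^ p ≤ (4 * Real.pi) ^ p / (p - 1) *
      (t ^ (p - 1) - (1 / ((⌊1 / t⌋₊ : ℝ) + 1)) ^ (p - 1)) := by
  obtain ⟨a, b, c⟩ := floor_facts ht ht1
  have := piece_bound hp a (s := 1 / ((⌊1 / t⌋₊ : ℝ) + 1)) (t := t) (by positivity)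
    (by rwa [one_div_le (by positivity) ht]) b (by rw [one_div_one_div])
  have z : lp (1 / ((⌊1 / t⌋₊ : ℝ) + 1)) = 0 := by exact_mod_cast lp_inv (⌊1 / t⌋₊ + 1)
  rwa [z, sub_zero] at this

lemma end_bound {p : ℝ} (hp : 1 < p) {t : ℝ} (ht : 0 < t) (ht1 : t ≤ 1) :
    ‖lp t‖ ^ p ≤ (4 * Real.pi) ^ p / (p - 1) *
      ((1 / (⌊1 / t⌋₊ : ℝ)) ^ (p - 1) - t ^ (p - 1)) := by
  obtain ⟨a, b, c⟩ := floor_facts ht ht1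
  have a' : (0 : ℝ) < ⌊1 / t⌋₊ := by exact_mod_cast a
  have := piece_bound hp a (s := t) (t := 1 / (⌊1 / t⌋₊ : ℝ)) ht
    (by rwa [le_one_div ht a']) (by rw [one_div_one_div]) c
  rwa [lp_inv, zero_sub, norm_neg] at this

lemma control {p : ℝ} (hp : 1 < p) : ∃ C : ℝ, 0 ≤ C ∧ ∀ s t : ℝ, 0 ≤ s → s ≤ t → t ≤ 1 →
    ‖lp t - lp s‖ ^ p ≤ C * (t ^ (p - 1) - s ^ (p - 1)) := by
  have hpi := Real.pi_pos
  have hp1 : 0 < p - 1 := by linarith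
  set K := (4 * Real.pi) ^ p / (p - 1) with hK
  have hK0 : 0 ≤ K := by positivity
  have h2 : (1 : ℝ) ≤ 2 ^ (p - 1) := Real.one_le_rpow (by norm_num) hp1.le
  refine ⟨2 ^ (p - 1) * K, by positivity, fun s t hs hst ht1 => ?_⟩
  have mono : ∀ a b : ℝ, 0 ≤ a → a ≤ b → a ^ (p - 1) ≤ b ^ (p - 1) := fun a b ha hab =>
    Real.rpow_le_rpow ha hab hp1.le
  have key : ∀ X : ℝ, X ≤ K * (t ^ (p - 1) - s ^ (p - 1)) →
      X ≤ 2 ^ (p - 1) * K * (t ^ (p - 1) - s ^ (p - 1)) := by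
    intro X hX
    have : 0 ≤ K * (t ^ (p - 1) - s ^ (p - 1)) :=
      mul_nonneg hK0 (sub_nonneg.2 (mono _ _ hs hst))
    nlinarith
  rcases hs.eq_or_lt with rfl | hs
  · rcases hst.eq_or_lt with rfl | ht
    · simp [Real.zero_rpow (by linarith : p ≠ 0)]
    · apply key
      rw [lp_zero, sub_zero, Real.zero_rpow hp1.ne', sub_zero]
      refine (start_bound hp ht ht1).trans ?_
      gcongr
      have : 0 ≤ (1 / ((⌊1 / t⌋₊ : ℝ) + 1)) ^ (p - 1) := by positivity
      linarith
  · have ht := hs.trans_le hst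
    obtain ⟨a, b, c⟩ := floor_facts ht ht1
    obtain ⟨a', b', c'⟩ := floor_facts hs (hst.trans ht1)
    have hts : 1 / t ≤ 1 / s := one_div_le_one_div_of_le hs hst
    have hfl : ⌊1 / t⌋₊ ≤ ⌊1 / s⌋₊ := Nat.floor_mono hts
    rcases hfl.eq_or_lt with h | h
    · apply key
      exact piece_bound hp a hs hst b (by rw [h]; exact c')
    · have h' : (⌊1 / t⌋₊ : ℝ) + 1 ≤ ⌊1 / s⌋₊ := by exact_mod_cast h
      have A := start_bound hp ht ht1
      have B := end_bound hp hs (hst.trans ht1)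
      have M := mono (1 / (⌊1 / s⌋₊ : ℝ)) (1 / ((⌊1 / t⌋₊ : ℝ) + 1)) (by positivity)
        (one_div_le_one_div_of_le (by positivity) h')
      have T : ‖lp t - lp s‖ ^ p ≤ 2 ^ (p - 1) * (‖lp t‖ ^ p + ‖lp s‖ ^ p) := by
        refine (Real.rpow_le_rpow (norm_nonneg _) (norm_sub_le _ _) (by linarith)).trans ?_
        have := NNReal.rpow_add_le_mul_rpow_add_rpow ‖lp t‖₊ ‖lp s‖₊ hp.le
        exact_mod_cast this
      refine T.trans ?_
      rw [mul_assoc]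
      gcongr
      nlinarith

lemma lp_pvar (p : ℝ) (hp : 1 < p) : ∃ C : ℝ, ∀ (k : ℕ) (t : ℕ → ℝ), Monotone t →
        (∀ i, t i ∈ Set.Icc (0 : ℝ) 1) →
        ∑ i ∈ Finset.range k, ‖lp (t (i + 1)) - lp (t i)‖ ^ p ≤ C := by
  obtain ⟨C, hC, h⟩ := control hp
  refine ⟨C, fun k t ht h01 => ?_⟩
  calc ∑ i ∈ Finset.range k, ‖lp (t (i + 1)) - lp (t i)‖ ^ p
      ≤ ∑ i ∈ Finset.range k, C * ((t (i+1)) ^ (p - 1) - (t i) ^ (p - 1)) :=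
        Finset.sum_le_sum fun i _ => h _ _ (h01 i).1 (ht (Nat.le_succ i)) (h01 _).2
    _ = C * ((t k) ^ (p - 1) - (t 0) ^ (p - 1)) := by
        rw [← Finset.mul_sum, Finset.sum_range_sub (fun i => (t i) ^ (p - 1))]
    _ ≤ C * 1 := by
        gcongr
        have := Real.rpow_le_one (h01 k).1 (h01 k).2 (by linarith : 0 ≤ p - 1)
        have := Real.rpow_nonneg (h01 0).1 (p - 1)
        linarith
    _ = C := mul_one C

lemma lp_cont : ContinuousOn lp (Set.Icc 0 1) := by
  obtain ⟨C, hC, h⟩ := control (p := 2) (by norm_num)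
  have h' : ∀ s ∈ Set.Icc (0:ℝ) 1, ∀ t ∈ Set.Icc (0:ℝ) 1, ‖lp t - lp s‖ ≤ √(C * |t - s|) := by
    intro s hs t ht
    apply Real.le_sqrt_of_sq_le
    rcases le_total s t with hst | hst
    · have := h s t hs.1 hst ht.2
      norm_num at this
      rwa [abs_of_nonneg (by linarith)]
    · have := h t s ht.1 hst hs.2
      norm_num at this
      rwa [abs_sub_comm, norm_sub_rev, abs_of_nonneg (by linarith)]
  intro s hs
  rw [ContinuousWithinAt, tendsto_iff_norm_sub_tendsto_zero]
  have lim : Filter.Tendsto (fun t => √(C * |t - s|)) (nhdsWithin s (Set.Icc 0 1)) (nhds 0) := by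
    have : Continuous fun t : ℝ => √(C * |t - s|) := by fun_prop
    have := this.tendsto s
    simp only [sub_self, abs_zero, mul_zero, Real.sqrt_zero] at this
    exact this.mono_left nhdsWithin_le_nhds
  refine squeeze_zero' (Filter.Eventually.of_forall fun _ => norm_nonneg _) ?_ lim
  filter_upwards [self_mem_nhdsWithin] with t ht using h' s hs t ht

/-- If `h` is a continuous logarithm of the `C¹` path `f`, then `∫ f'/f` is its increment. -/
lemma integral_logDeriv_eq {f h : ℝ → ℂ} {a b : ℝ} (hab : a ≤ b) (hf : ContDiff ℝ 1 f)
    (hh : ContinuousOn h (Set.Icc a b)) (hexp : ∀ s ∈ Set.Icc a b, Complex.exp (h s) = f s) :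
    ∫ s in a..b, deriv f s / f s = h b - h a := by
  have hf0 : ∀ s ∈ Set.Icc a b, f s ≠ 0 := fun s hs => by
    rw [← hexp s hs]; exact Complex.exp_ne_zero _
  apply intervalIntegral.integral_eq_sub_of_hasDerivAt_of_le hab hh
  · intro s hs
    have hs' := Set.Ioo_subset_Icc_self hs
    have hnhds : Set.Icc a b ∈ nhds s := Icc_mem_nhds hs.1 hs.2
    have hcont : ContinuousAt h s := hh.continuousAt hnhds
    have hd : HasDerivAt f (deriv f s) s := ((hf.differentiable (by norm_num)) s).hasDerivAt
    have hd2 : HasDerivAt (fun u => h s + Complex.log (f u / f s)) (deriv f s / f s) s := by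
      have h1 : HasDerivAt (fun u => f u / f s) (deriv f s / f s) s := hd.div_const _
      have h2 := h1.clog_real (by simp [div_self (hf0 s hs')])
      rw [div_self (hf0 s hs'), div_one] at h2
      exact h2.const_add _
    refine hd2.congr_of_eventuallyEq ?_
    have him : ∀ᶠ u in nhds s, |(h u - h s).im| < Real.pi := by
      have : ContinuousAt (fun u => |(h u - h s).im|) s := by fun_prop
      apply this.eventually_lt continuousAt_const
      simpa using Real.pi_pos
    filter_upwards [him, hnhds] with u hu hu'
    rw [abs_lt] at hu
    rw [← hexp u hu', ← hexp s hs', ← Complex.exp_sub, Complex.log_exp hu.1 hu.2.le]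
    ring
  · apply ContinuousOn.intervalIntegrable
    rw [Set.uIcc_of_le hab]
    exact ((hf.continuous_deriv (by norm_num)).continuousOn).div hf.continuous.continuousOn hf0

lemma exists_log {f : ℝ → ℂ} (hf : ContinuousOn f (Set.Icc 0 1))
    (h0 : ∀ s ∈ Set.Icc (0 : ℝ) 1, f s ≠ 0) :
    ∃ g : ℝ → ℂ, ContinuousOn g (Set.Icc 0 1) ∧
      ∀ s ∈ Set.Icc (0 : ℝ) 1, Complex.exp (g s) = f s := by
  let γ : C(unitInterval, {z : ℂ // z ≠ 0}) :=
    ⟨fun s => ⟨f s, h0 s s.2⟩, (continuousOn_iff_continuous_domRestrict.1 hf).subtype_mk _⟩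
  obtain ⟨Γ, hΓ, -⟩ := Complex.isCoveringMap_exp.exists_path_lifts γ (Complex.log (f 0))
    (Subtype.ext (Complex.exp_log (h0 0 (by simp))).symm)
  refine ⟨Set.IccExtend zero_le_one Γ, ?_, fun s hs => ?_⟩
  · exact (Γ.continuous.Icc_extend' (h := zero_le_one)).continuousOn
  · rw [Set.IccExtend_of_mem _ _ hs]
    exact congrArg Subtype.val (congrFun hΓ ⟨s, hs⟩)

/-- The integral over an approximating loop is the increment of the logarithm. -/
lemma approx_integral {l g γ : ℝ → ℂ} {x : ℂ} (hl : ContinuousOn l (Set.Icc 0 1))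
    (hl01 : l 0 = l 1) (hg : ContinuousOn g (Set.Icc 0 1))
    (hexp : ∀ s ∈ Set.Icc (0 : ℝ) 1, Complex.exp (g s) = l s - x)
    (hγ : ContDiff ℝ 1 γ) (hγ01 : γ 0 = γ 1)
    (hclose : ∀ s ∈ Set.Icc (0 : ℝ) 1,
      dist (γ s) (l s) < Metric.infDist x (l '' Set.Icc 0 1)) :
    ∫ s in (0 : ℝ)..1, deriv γ s / (γ s - x) = g 1 - g 0 := by
  have hne : ∀ s ∈ Set.Icc (0 : ℝ) 1, l s - x ≠ 0 := fun s hs => by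
    rw [← hexp s hs]; exact Complex.exp_ne_zero _
  have hslit : ∀ s ∈ Set.Icc (0 : ℝ) 1, (γ s - x) / (l s - x) ∈ Complex.slitPlane := by
    intro s hs
    apply Complex.ball_one_subset_slitPlane
    rw [mem_ball_iff_norm]
    have e : (γ s - x) / (l s - x) - 1 = (γ s - l s) / (l s - x) := by
      have := hne s hs
      field_simp
      ring
    rw [e, norm_div, div_lt_one (norm_pos_iff.2 (hne s hs)), ← dist_eq_norm, ← dist_eq_norm,
      dist_comm (l s) x]
    exact (hclose s hs).trans_le (Metric.infDist_le_dist_of_mem (Set.mem_image_of_mem _ hs))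
  have := integral_logDeriv_eq (f := fun s => γ s - x)
    (h := fun s => g s + Complex.log ((γ s - x) / (l s - x))) (zero_le_one)
    (hγ.sub contDiff_const) ?_ ?_
  · simp only [deriv_sub_const] at this
    rw [this, hγ01, hl01]
    ring
  · refine hg.add (ContinuousOn.clog ?_ hslit)
    exact (hγ.continuous.continuousOn.sub continuousOn_const).div
      (hl.sub continuousOn_const) hne
  · intro s hs
    have h1 := hne s hs
    rw [Complex.exp_add, hexp s hs, Complex.exp_log (Complex.slitPlane_ne_zero (hslit s hs))]
    field_simp

lemma lp_circle {k : ℕ} (hk : 1 ≤ k) {θ : ℝ} (h0 : 0 ≤ θ) (h1 : θ ≤ 2 * Real.pi) :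
    lp (1 / ((k + 1 : ℝ) - θ / (2 * Real.pi))) = circleMap (-(1 / k : ℂ)) (1 / k) θ := by
  have hk' : (1 : ℝ) ≤ k := by exact_mod_cast hk
  have hθ : 0 ≤ θ / (2 * Real.pi) := div_nonneg h0 Real.two_pi_pos.le
  have hθ1 : θ / (2 * Real.pi) ≤ 1 := by rwa [div_le_one Real.two_pi_pos]
  rw [lp_piece (n := k) (by rw [one_div_one_div]; linarith) (by rw [one_div_one_div]; linarith),
    one_div_one_div]
  have : ee ((k + 1 : ℝ) - θ / (2 * Real.pi)) = Complex.exp (θ * Complex.I) := by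
    have e1 := ee_nat (k + 1)
    unfold ee at e1 ⊢
    rw [← mul_one (Complex.exp (θ * Complex.I)), ← e1, ← Complex.exp_add]
    congr 1
    have := Real.pi_ne_zero
    push_cast
    have : (Real.pi : ℂ) ≠ 0 := by exact_mod_cast this
    field_simp
    ring
  rw [this, circleMap]
  push_cast
  ring

/-- The increment of the logarithm along one circle. -/
lemma step {g : ℝ → ℂ} {x : ℂ} (hg : ContinuousOn g (Set.Icc 0 1))
    (hexp : ∀ s ∈ Set.Icc (0 : ℝ) 1, Complex.exp (g s) = lp s - x) {k : ℕ} (hk : 1 ≤ k) :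
    g (1 / k) - g (1 / (k + 1)) = ∮ z in C(-(1 / k : ℂ), 1 / k), (z - x)⁻¹ := by
  have hk' : (1 : ℝ) ≤ k := by exact_mod_cast hk
  have hpi := Real.two_pi_pos
  have hden : ∀ θ ∈ Set.Icc 0 (2 * Real.pi), 1 ≤ (k + 1 : ℝ) - θ / (2 * Real.pi) := by
    intro θ hθ
    have : θ / (2 * Real.pi) ≤ 1 := by rw [div_le_one hpi]; exact hθ.2
    linarith
  have hmem : ∀ θ ∈ Set.Icc 0 (2 * Real.pi),
      1 / ((k + 1 : ℝ) - θ / (2 * Real.pi)) ∈ Set.Icc (0 : ℝ) 1 := by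
    intro θ hθ
    have := hden θ hθ
    exact ⟨by positivity, by rw [div_le_one (by linarith)]; exact this⟩
  have := integral_logDeriv_eq (a := 0) (b := 2 * Real.pi)
    (f := fun θ => circleMap (-(1 / k : ℂ)) (1 / k) θ - x)
    (h := fun θ => g (1 / ((k + 1 : ℝ) - θ / (2 * Real.pi)))) hpi.le
    ((contDiff_circleMap _ _).sub contDiff_const) ?_ ?_
  · simp only [deriv_sub_const] at this
    rw [div_self hpi.ne', zero_div, sub_zero, add_sub_cancel_right] at this
    rw [← this, circleIntegral]
    simp only [smul_eq_mul, div_eq_mul_inv]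
  · refine hg.comp ?_ hmem
    refine continuousOn_const.div (by fun_prop) ?_
    intro θ hθ
    have := hden θ hθ
    linarith
  · intro θ hθ
    rw [hexp _ (hmem θ hθ), lp_circle hk hθ.1 hθ.2]

lemma circle_outside {c x : ℂ} {R : ℝ} (hR : 0 ≤ R) (hx : x ∉ Metric.closedBall c R) :
    ∮ z in C(c, R), (z - x)⁻¹ = 0 := by
  have hne : ∀ z ∈ Metric.closedBall c R, z - x ≠ 0 := by
    intro z hz h
    rw [sub_eq_zero] at h
    exact hx (h ▸ hz)
  refine Complex.circleIntegral_eq_zero_of_differentiable_on_off_countable hR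
    Set.countable_empty ?_ ?_
  · exact (continuousOn_id.sub continuousOn_const).inv₀ hne
  · intro z hz
    exact (differentiableAt_id.sub_const x).inv (hne z (Metric.ball_subset_closedBall hz.1))

lemma ball_nested {j k : ℕ} (hj : 1 ≤ j) (hjk : j ≤ k) :
    Metric.ball (-(1 / k : ℂ)) (1 / k) ⊆ Metric.ball (-(1 / j : ℂ)) (1 / j) := by
  apply Metric.ball_subset_ball'
  have hj' : (0 : ℝ) < j := by exact_mod_cast hj
  have hjk' : (j : ℝ) ≤ k := by exact_mod_cast hjk
  have h := one_div_le_one_div_of_le hj' hjk'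
  have e : dist (-(1 / k : ℂ)) (-(1 / j : ℂ)) = 1 / j - 1 / k := by
    rw [dist_eq_norm]
    have : (-(1 / k : ℂ)) - (-(1 / j : ℂ)) = ((1 / j - 1 / k : ℝ) : ℂ) := by push_cast; ring
    rw [this, Complex.norm_real, Real.norm_of_nonneg (by linarith)]
  rw [e]; linarith

lemma winding_lower {g : ℝ → ℂ} {x : ℂ} {N : ℤ} (hg : ContinuousOn g (Set.Icc 0 1))
    (hexp : ∀ s ∈ Set.Icc (0 : ℝ) 1, Complex.exp (g s) = lp s - x)
    (hx : ∀ k : ℕ, x ∉ Metric.sphere (-(1 / k : ℂ)) (1 / k))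
    (hN : g 1 - g 0 = N * (2 * Real.pi * Complex.I)) {m : ℕ} (hm : 1 ≤ m)
    (hxm : x ∈ Metric.ball (-(1 / m : ℂ)) (1 / m)) : (m : ℤ) ≤ N := by
  classical
  have hst : ∀ k : ℕ, 1 ≤ k → (g (1 / k)).im - (g (1 / (k + 1))).im =
      if x ∈ Metric.ball (-(1 / k : ℂ)) (1 / k) then 2 * Real.pi else 0 := by
    intro k hk
    rw [← Complex.sub_im, step hg hexp hk]
    split_ifs with h
    · rw [circleIntegral.integral_sub_inv_of_mem_ball h]; simp
    · rw [circle_outside (by positivity)]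
      · simp
      · rw [← Metric.ball_union_sphere]
        exact fun h' => h'.elim h (hx k)
  have hpi := Real.two_pi_pos
  have hsum : ∀ j : ℕ, 2 * Real.pi * (min j m : ℕ) ≤ (g 1).im - (g (1 / (j + 1))).im := by
    intro j
    induction j with
    | zero => simp
    | succ j ih =>
      have h := hst (j + 1) (by omega)
      push_cast at h ⊢
      by_cases hj : j + 1 ≤ m
      · have hb : x ∈ Metric.ball (-(1 / (j + 1 : ℕ) : ℂ)) (1 / (j + 1 : ℕ)) :=
          ball_nested (by omega) hj hxm
        push_cast at hb
        rw [if_pos hb] at h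
        rw [min_eq_left (by omega)] at ih
        rw [min_eq_left (by exact_mod_cast hj)]
        linarith
      · rw [min_eq_right (by omega)] at ih
        rw [min_eq_right (by exact_mod_cast (by omega : m ≤ j + 1))]
        split_ifs at h <;> linarith
  have hlim : Filter.Tendsto (fun j : ℕ => (g 1).im - (g (1 / (j + 1))).im) Filter.atTop
      (nhds ((g 1).im - (g 0).im)) := by
    refine tendsto_const_nhds.sub ?_
    have h1 : Filter.Tendsto (fun j : ℕ => (1 : ℝ) / (j + 1)) Filter.atTop
        (nhdsWithin 0 (Set.Icc 0 1)) := by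
      refine tendsto_nhdsWithin_iff.2 ⟨tendsto_one_div_add_atTop_nhds_zero_nat,
        Filter.Eventually.of_forall fun j => ⟨by positivity, ?_⟩⟩
      rw [div_le_one (by positivity)]
      linarith [Nat.cast_nonneg (α := ℝ) j]
    exact (Complex.continuous_im.tendsto _).comp ((hg 0 (by simp)).tendsto.comp h1)
  have hge : 2 * Real.pi * (m : ℝ) ≤ (g 1).im - (g 0).im := by
    refine ge_of_tendsto hlim ?_
    filter_upwards [Filter.eventually_ge_atTop m] with j hj
    have := hsum j
    rwa [min_eq_right hj] at this
  rw [← Complex.sub_im, hN] at hge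
  have : (N * (2 * Real.pi * Complex.I) : ℂ).im = 2 * Real.pi * N := by
    have : (N * (2 * Real.pi * Complex.I) : ℂ) = ((2 * Real.pi * N : ℝ) : ℂ) * Complex.I := by
      push_cast; ring
    rw [this, Complex.im_ofReal_mul, Complex.I_im, mul_one]
  rw [this] at hge
  exact_mod_cast le_of_mul_le_mul_left hge hpi

lemma lp_mem_sphere (t : ℝ) :
    ∃ k : ℕ, lp t ∈ Metric.sphere (-(1 / k : ℂ)) (1 / k) := by
  refine ⟨⌊1 / t⌋₊, ?_⟩
  rw [mem_sphere_iff_norm, lp_def]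
  have : (ee (1 / t) - 1) / (⌊1 / t⌋₊ : ℂ) - -(1 / (⌊1 / t⌋₊ : ℂ)) = ee (1 / t) / ⌊1 / t⌋₊ := by
    ring
  rw [this, norm_div, norm_ee, Complex.norm_natCast]

lemma ae_off_spheres : ∀ᵐ x : ℂ, ∀ k : ℕ, x ∉ Metric.sphere (-(1 / k : ℂ)) (1 / k) := by
  rw [ae_all_iff]
  intro k
  exact measure_eq_zero_iff_ae_notMem.1 (Measure.addHaar_sphere _ _ _)

lemma sum_odd_le (K : ℕ) (N : ℤ) (P : ℕ → Prop) [DecidablePred P]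
    (h : ∀ k < K, P k → ((k + 1 : ℕ) : ℤ) ≤ N) :
    (∑ k ∈ Finset.range K, if P k then (2 * (k : ℝ) + 1) else 0) ≤ (N : ℝ) ^ 2 := by
  have hodd : ∀ M : ℕ, ∑ k ∈ Finset.range M, (2 * (k : ℝ) + 1) = (M : ℝ) ^ 2 := by
    intro M
    induction M with
    | zero => simp
    | succ M ih => rw [Finset.sum_range_succ, ih]; push_cast; ring
  rcases lt_or_ge N 0 with hN | hN
  · rw [Finset.sum_eq_zero]
    · positivity
    · intro k hk
      rw [if_neg]
      intro hP
      have := h k (Finset.mem_range.1 hk) hP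
      omega
  · lift N to ℕ using hN
    have e : ((N : ℤ) : ℝ) = N := by norm_cast
    rw [e, ← hodd, ← Finset.sum_filter]
    apply Finset.sum_le_sum_of_subset_of_nonneg
    · intro k hk
      rw [Finset.mem_filter, Finset.mem_range] at hk
      have := h k hk.1 hk.2
      rw [Finset.mem_range]
      omega
    · intros; positivity

lemma lintegral_top (n : ℂ → ℤ)
    (h : ∀ᵐ x : ℂ, ∀ m : ℕ, 1 ≤ m → x ∈ Metric.ball (-(1 / m : ℂ)) (1 / m) → (m : ℤ) ≤ n x) :
    ∫⁻ x : ℂ, ENNReal.ofReal ((n x : ℝ) ^ 2) = ⊤ := by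
  classical
  let D : ℕ → Set ℂ := fun k => Metric.ball (-(1 / (k + 1 : ℕ) : ℂ)) (1 / (k + 1 : ℕ))
  have hle : ∀ K : ℕ, ENNReal.ofReal (∑ k ∈ Finset.range K, 1 / ((k : ℝ) + 1)) ≤
      ∫⁻ x : ℂ, ENNReal.ofReal ((n x : ℝ) ^ 2) := by
    intro K
    calc ENNReal.ofReal (∑ k ∈ Finset.range K, 1 / ((k : ℝ) + 1))
        = ∑ k ∈ Finset.range K, ENNReal.ofReal (1 / ((k : ℝ) + 1)) :=
          ENNReal.ofReal_sum_of_nonneg fun _ _ => by positivity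
      _ ≤ ∑ k ∈ Finset.range K, ENNReal.ofReal (2 * (k : ℝ) + 1) * volume (D k) := by
          refine Finset.sum_le_sum fun k _ => ?_
          have e : volume (D k) = ENNReal.ofReal (Real.pi * (1 / ((k : ℝ) + 1)) ^ 2) := by
            simp only [D]
            rw [Complex.volume_ball, mul_comm, ENNReal.ofReal_mul Real.pi_pos.le,
              ENNReal.ofReal_pow (by positivity), ← NNReal.coe_real_pi, ENNReal.ofReal_coe_nnreal]
            push_cast
            rfl
          rw [e, ← ENNReal.ofReal_mul (by positivity)]
          apply ENNReal.ofReal_le_ofReal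
          have h3 := Real.pi_gt_three
          have : (0 : ℝ) ≤ k := Nat.cast_nonneg k
          have e2 : (2 * (k : ℝ) + 1) * (Real.pi * (1 / ((k : ℝ) + 1)) ^ 2) =
            (1 / ((k : ℝ) + 1)) * ((2 * (k : ℝ) + 1) * Real.pi / (k + 1)) := by
            field_simp
          rw [e2]
          apply le_mul_of_one_le_right (by positivity)
          rw [one_le_div (by positivity)]
          nlinarith
      _ = ∫⁻ x : ℂ, ∑ k ∈ Finset.range K,
            (D k).indicator (fun _ => ENNReal.ofReal (2 * (k : ℝ) + 1)) x := by
          rw [lintegral_finsetSum]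
          · refine Finset.sum_congr rfl fun k _ => ?_
            rw [lintegral_indicator Metric.isOpen_ball.measurableSet, setLIntegral_const]
          · intro k _
            exact measurable_const.indicator Metric.isOpen_ball.measurableSet
      _ ≤ ∫⁻ x : ℂ, ENNReal.ofReal ((n x : ℝ) ^ 2) := by
          apply lintegral_mono_ae
          filter_upwards [h] with x hx
          have := sum_odd_le K (n x) (fun k => x ∈ D k) (fun k _ hk => hx (k + 1) (by omega) hk)
          refine le_trans (le_of_eq ?_) (ENNReal.ofReal_le_ofReal this)
          rw [ENNReal.ofReal_sum_of_nonneg]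
          · refine Finset.sum_congr rfl fun k _ => ?_
            rw [Set.indicator_apply]
            split_ifs <;> simp
          · intro k _
            split_ifs <;> positivity
  have hlim := ENNReal.tendsto_ofReal_atTop.comp Real.tendsto_sum_range_one_div_nat_succ_atTop
  exact top_unique (le_of_tendsto' hlim hle)

lemma exists_winding (x : ℂ) (hx : x ∉ lp '' Set.Icc 0 1) : ∃ (N : ℤ) (g : ℝ → ℂ),
    ContinuousOn g (Set.Icc 0 1) ∧
    (∀ s ∈ Set.Icc (0 : ℝ) 1, Complex.exp (g s) = lp s - x) ∧
    g 1 - g 0 = N * (2 * Real.pi * Complex.I) := by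
  obtain ⟨g, hg, hexp⟩ := exists_log (f := fun s => lp s - x) (lp_cont.sub continuousOn_const)
    (fun s hs h => hx ⟨s, hs, sub_eq_zero.1 h⟩)
  have : Complex.exp (g 1) = Complex.exp (g 0) := by
    rw [hexp 1 (by simp), hexp 0 (by simp), lp_zero, lp_one]
  obtain ⟨N, hN⟩ := Complex.exp_eq_exp_iff_exists_int.1 this
  exact ⟨N, g, hg, hexp, by rw [hN]; ring⟩

end LoopWinding

/-- There exists a continuous loop `l : [0,1] → ℝ² = ℂ` of finite `p`-variation for
every `p > 1` whose topological winding-number function `n_l` is not square-integrable: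
`∫_{ℝ²} n_l(x)² dx = +∞`.  The winding number `n_l(x)` of `l` around a point `x` off the
range of `l` is characterized by the integral `(1/2πi) ∮ dz/(z−x)` computed along any
(C¹) loop uniformly closer to `l` than the distance from `x` to the range of `l`. -/
theorem exists_loop_finite_pvariation_winding_not_square_integrable :
    ∃ (l : ℝ → ℂ) (n : ℂ → ℤ),
      ContinuousOn l (Set.Icc 0 1) ∧ l 0 = l 1 ∧
      (∀ p : ℝ, 1 < p → ∃ C : ℝ, ∀ (k : ℕ) (t : ℕ → ℝ), Monotone t →
        (∀ i, t i ∈ Set.Icc (0 : ℝ) 1) →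
        ∑ i ∈ Finset.range k, ‖l (t (i + 1)) - l (t i)‖ ^ p ≤ C) ∧
      (∀ x : ℂ, x ∉ l '' Set.Icc 0 1 →
        ∀ γ : ℝ → ℂ, ContDiff ℝ 1 γ → γ 0 = γ 1 →
          (∀ s ∈ Set.Icc (0 : ℝ) 1, dist (γ s) (l s) < Metric.infDist x (l '' Set.Icc 0 1)) →
          (n x : ℂ) = (1 / (2 * Real.pi * Complex.I)) *
            ∫ s in (0 : ℝ)..1, deriv γ s / (γ s - x)) ∧
      ∫⁻ x : ℂ, ENNReal.ofReal ((n x : ℝ) ^ 2) = ⊤ := by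
  classical
  choose! n g hg hexp hN using LoopWinding.exists_winding
  refine ⟨LoopWinding.lp, n, LoopWinding.lp_cont, by rw [LoopWinding.lp_zero, LoopWinding.lp_one],
    LoopWinding.lp_pvar, ?_, ?_⟩
  · intro x hx γ hγ hγ01 hclose
    rw [LoopWinding.approx_integral LoopWinding.lp_cont
      (by rw [LoopWinding.lp_zero, LoopWinding.lp_one]) (hg x hx) (hexp x hx) hγ hγ01 hclose,
      hN x hx]
    have : (Real.pi : ℂ) ≠ 0 := by exact_mod_cast Real.pi_ne_zero
    have := Complex.I_ne_zero
    field_simp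
  · apply LoopWinding.lintegral_top
    filter_upwards [LoopWinding.ae_off_spheres] with x hx m hm hxm
    have hx' : x ∉ LoopWinding.lp '' Set.Icc 0 1 := by
      rintro ⟨t, -, rfl⟩
      obtain ⟨k, hk⟩ := LoopWinding.lp_mem_sphere t
      exact hx k hk
    exact LoopWinding.winding_lower (hg x hx') (hexp x hx') hx (hN x hx') hm hxm
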